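/- arXiv:2107.10385 — 3 statements merged into one kernel-verified Lean document; each statement's English description precedes it below -/
import Mathlib

section
/- Let G be an SU² grid. For every d ∈ {0,…,N} and every E ⊆ {0,…,N}, the degree-d Z*-closure of E equals L̄_{N,d}(E), i.e. Z*-cl_{G,d}(E) = L̄_{N,d}(E). -/
open MvPolynomial

noncomputable section

namespace CoveringSymmetric

/-- `N = ∑ᵢ (kᵢ - 1)` for the uniform grid `[0,k₁-1] × ⋯ × [0,kₙ-1]`. -/
def Ntot (n : ℕ) (k : Fin n → ℕ) : ℕ := ∑ i, (k i - 1)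

/-- The integer points of the uniform grid `G = [0,k₁-1] × ⋯ × [0,kₙ-1]`. -/
def gridSet (n : ℕ) (k : Fin n → ℕ) : Set (Fin n → ℕ) := {x | ∀ i, x i < k i}

/-- The real point of `ℝⁿ` corresponding to an integer point. -/
def toR {n : ℕ} (x : Fin n → ℕ) : Fin n → ℝ := fun i => (x i : ℝ)

/-- The weight `wt(x) = ∑ᵢ xᵢ` of a point. -/
def wt {n : ℕ} (x : Fin n → ℕ) : ℕ := ∑ i, x i

/-- The weight-determined set `E̲ = {x ∈ G : wt(x) ∈ E}`. -/
def wdSet (n : ℕ) (k : Fin n → ℕ) (E : Finset ℕ) : Set (Fin n → ℕ) :=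
  {x ∈ gridSet n k | wt x ∈ E}

/-- The layer `j̲ = {x ∈ G : wt(x) = j}`. -/
def layer (n : ℕ) (k : Fin n → ℕ) (j : ℕ) : Set (Fin n → ℕ) :=
  {x ∈ gridSet n k | wt x = j}

/-- The grid is strictly unimodal (SU²):
`|0̲| < ⋯ < |⌊N/2⌋̲| = |⌈N/2⌉̲| > ⋯ > |N̲|`. -/
def SU2 (n : ℕ) (k : Fin n → ℕ) : Prop :=
  (∀ j, j < Ntot n k / 2 → (layer n k j).ncard < (layer n k (j + 1)).ncard) ∧
  (layer n k (Ntot n k / 2)).ncard = (layer n k ((Ntot n k + 1) / 2)).ncard ∧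
  (∀ j, (Ntot n k + 1) / 2 ≤ j → j < Ntot n k →
    (layer n k (j + 1)).ncard < (layer n k j).ncard)

/-- The zero set `Z_G(P)` of a polynomial within the grid. -/
def ZG (n : ℕ) (k : Fin n → ℕ) (P : MvPolynomial (Fin n) ℝ) : Set (Fin n → ℕ) :=
  {x ∈ gridSet n k | eval (toR x) P = 0}

/-- The degree-`d` Zariski closure of `S ⊆ G` within the grid. -/
def Zcl (n : ℕ) (k : Fin n → ℕ) (d : ℕ) (S : Set (Fin n → ℕ)) : Set (Fin n → ℕ) :=
  {a ∈ gridSet n k | ∀ P : MvPolynomial (Fin n) ℝ, P.totalDegree ≤ d →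
    (∀ x ∈ S, eval (toR x) P = 0) → eval (toR a) P = 0}

/-- The degree-`d` Z*-closure of a weight-determined set, as a set of weights:
`{j ∈ [0,N] : j̲ ⊆ Z-cl_{G,d}(E̲)}`. -/
def Zstar (n : ℕ) (k : Fin n → ℕ) (d : ℕ) (E : Finset ℕ) : Set ℕ :=
  {j | j ≤ Ntot n k ∧ layer n k j ⊆ Zcl n k d (wdSet n k E)}

/-- `PC_G(E)`: minimum total degree of a nontrivial polynomial cover of `E̲`. -/
def PC (n : ℕ) (k : Fin n → ℕ) (E : Finset ℕ) : ℕ :=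
  sInf {d | ∃ P : MvPolynomial (Fin n) ℝ, P.totalDegree = d ∧
    wdSet n k E ⊆ ZG n k P ∧ ZG n k P ≠ gridSet n k}

/-- `PPC_G(E)`: minimum total degree of a proper polynomial cover of `E̲`. -/
def PPC (n : ℕ) (k : Fin n → ℕ) (E : Finset ℕ) : ℕ :=
  sInf {d | ∃ P : MvPolynomial (Fin n) ℝ, P.totalDegree = d ∧
    wdSet n k E ⊆ ZG n k P ∧
    ∀ j ≤ Ntot n k, j ∉ E → ¬ (layer n k j ⊆ ZG n k P)}

/-- `EPC_G(E)`: minimum total degree of an exact polynomial cover of `E̲`. -/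
def EPC (n : ℕ) (k : Fin n → ℕ) (E : Finset ℕ) : ℕ :=
  sInf {d | ∃ P : MvPolynomial (Fin n) ℝ, P.totalDegree = d ∧ ZG n k P = wdSet n k E}

/-- `x` lies on the affine hyperplane `{y ∈ ℝⁿ : ∑ᵢ wᵢ yᵢ = c}` (with `w ≠ 0`). -/
def onHyp {n : ℕ} (w : Fin n → ℝ) (c : ℝ) (x : Fin n → ℕ) : Prop :=
  ∑ i, w i * (x i : ℝ) = c

/-- `HC_G(E)`: minimum size of a nontrivial hyperplane cover of `E̲`. -/
def HC (n : ℕ) (k : Fin n → ℕ) (E : Finset ℕ) : ℕ :=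
  sInf {m | ∃ (w : Fin m → Fin n → ℝ) (c : Fin m → ℝ), (∀ t, w t ≠ 0) ∧
    (∀ x ∈ wdSet n k E, ∃ t, onHyp (w t) (c t) x) ∧
    ∃ x ∈ gridSet n k, ∀ t, ¬ onHyp (w t) (c t) x}

/-- `PHC_G(E)`: minimum size of a proper hyperplane cover of `E̲`. -/
def PHC (n : ℕ) (k : Fin n → ℕ) (E : Finset ℕ) : ℕ :=
  sInf {m | ∃ (w : Fin m → Fin n → ℝ) (c : Fin m → ℝ), (∀ t, w t ≠ 0) ∧
    (∀ x ∈ wdSet n k E, ∃ t, onHyp (w t) (c t) x) ∧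
    ∀ j ≤ Ntot n k, j ∉ E → ¬ (layer n k j ⊆ {x | ∃ t, onHyp (w t) (c t) x})}

/-- The certifying degree of `S ⊆ G`: least `d ∈ [0,N]` such that some polynomial of
total degree at most `d` is nonconstant on `G` but constant on `S`. -/
def certDeg (n : ℕ) (k : Fin n → ℕ) (S : Set (Fin n → ℕ)) : ℕ :=
  sInf {d | d ≤ Ntot n k ∧ ∃ f : MvPolynomial (Fin n) ℝ, f.totalDegree ≤ d ∧
    (∃ a ∈ gridSet n k, ∃ b ∈ gridSet n k, eval (toR a) f ≠ eval (toR b) f) ∧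
    ∀ a ∈ S, ∀ b ∈ S, eval (toR a) f = eval (toR b) f}

/-- `T_{N,i} = [0,i-1] ∪ [N-i+1,N]` (so `T_{N,0} = ∅`). -/
def T (N i : ℕ) : Finset ℕ := Finset.range i ∪ Finset.Icc (N - i + 1) N

/-- `E` is `(d,i)`-admitting: `E ∪ T_{N,i} ≠ [0,N]` and `|E \ T_{N,i}| ≤ d - i`. -/
def Admitting (N d i : ℕ) (E : Finset ℕ) : Prop :=
  E ∪ T N i ≠ Finset.range (N + 1) ∧ (E \ T N i).card ≤ d - i

/-- `E` is `d`-admitting: `(d,i)`-admitting for some `i ∈ [0,d]`. -/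
def DAdmitting (N d : ℕ) (E : Finset ℕ) : Prop :=
  ∃ i ≤ d, Admitting N d i E

/-- The operator `L_{N,d}`: if `E = {t₁ < ⋯ < t_s}` with `s ≥ d+1`, then
`L_{N,d}(E) = [0, t_{s-d}] ∪ E ∪ [t_{d+1}, N]`, and `L_{N,d}(E) = E` if `s ≤ d`.
(For `E ⊆ [0,N]`, `j ≤ t_{s-d}` iff `E` has at least `d+1` elements `≥ j`, and
`t_{d+1} ≤ j` iff `E` has at least `d+1` elements `≤ j`.) -/
def Lop (N d : ℕ) (E : Finset ℕ) : Finset ℕ :=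
  E ∪ (Finset.range (N + 1)).filter fun j =>
    d + 1 ≤ (E.filter fun t => j ≤ t).card ∨ d + 1 ≤ (E.filter fun t => t ≤ j).card

/-- `L̄_{N,d}(E) = ⋃ₘ L_{N,d}^m(E)`, the union of all iterates of `L_{N,d}` on `E`. -/
def Lbar (N d : ℕ) (E : Finset ℕ) : Set ℕ :=
  ⋃ m : ℕ, ((Lop N d)^[m] E : Set ℕ)

/-- `P` is a (possibly empty) product of polynomials of total degree at most 1. -/
def ProdLinear (n : ℕ) (P : MvPolynomial (Fin n) ℝ) : Prop :=
  ∃ (m : ℕ) (ℓ : Fin m → MvPolynomial (Fin n) ℝ),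
    (∀ t, (ℓ t).totalDegree ≤ 1) ∧ P = ∏ t, ℓ t

/-- The degree-`d` h-closure of `S ⊆ G`. -/
def hcl (n : ℕ) (k : Fin n → ℕ) (d : ℕ) (S : Set (Fin n → ℕ)) : Set (Fin n → ℕ) :=
  {a ∈ gridSet n k | ∀ P : MvPolynomial (Fin n) ℝ, ProdLinear n P → P.totalDegree ≤ d →
    (∀ x ∈ S, eval (toR x) P = 0) → eval (toR a) P = 0}

/-! ### Averaging over the layers of a cube -/

/-- The indicator of the subsets of `ι` that contain `S`. -/
def supersetInd {ι : Type*} [DecidableEq ι] (S : Finset ι) : Finset ι → ℝ :=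
  fun T => if S ⊆ T then 1 else 0

/-- The functions of degree at most `d` on the cube of subsets of `ι`. -/
def cubePoly (ι : Type*) [DecidableEq ι] (d : ℕ) : Submodule ℝ (Finset ι → ℝ) :=
  Submodule.span ℝ {f | ∃ S : Finset ι, S.card ≤ d ∧ f = supersetInd S}

section Cube

variable {ι : Type*} [DecidableEq ι]

lemma supersetInd_mem {S : Finset ι} {d : ℕ} (h : S.card ≤ d) :
    supersetInd S ∈ cubePoly ι d :=
  Submodule.subset_span ⟨S, h, rfl⟩

lemma supersetInd_empty : supersetInd (∅ : Finset ι) = 1 := by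
  ext T
  simp [supersetInd]

lemma supersetInd_mul (S S' : Finset ι) :
    supersetInd S * supersetInd S' = supersetInd (S ∪ S') := by
  ext T
  simp only [supersetInd, Pi.mul_apply, Finset.union_subset_iff]
  split_ifs <;> simp_all

lemma cubePoly_mono {d e : ℕ} (h : d ≤ e) : cubePoly ι d ≤ cubePoly ι e := by
  apply Submodule.span_mono
  rintro f ⟨S, hS, rfl⟩
  exact ⟨S, hS.trans h, rfl⟩

lemma one_mem_cubePoly (d : ℕ) : (1 : Finset ι → ℝ) ∈ cubePoly ι d := by
  rw [← supersetInd_empty]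
  exact supersetInd_mem (by simp)

lemma mul_mem_cubePoly {d e : ℕ} {f g : Finset ι → ℝ} (hf : f ∈ cubePoly ι d)
    (hg : g ∈ cubePoly ι e) : f * g ∈ cubePoly ι (d + e) := by
  have h : cubePoly ι d * cubePoly ι e ≤ cubePoly ι (d + e) := by
    unfold cubePoly
    rw [Submodule.span_mul_span]
    apply Submodule.span_mono
    rintro _ ⟨_, ⟨S, hS, rfl⟩, _, ⟨S', hS', rfl⟩, rfl⟩
    exact ⟨S ∪ S', (Finset.card_union_le _ _).trans (by omega), supersetInd_mul S S'⟩
  exact h (Submodule.mul_mem_mul hf hg)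

lemma pow_mem_cubePoly {f : Finset ι → ℝ} (hf : f ∈ cubePoly ι 1) (m : ℕ) :
    f ^ m ∈ cubePoly ι m := by
  induction m with
  | zero => simpa using one_mem_cubePoly 0
  | succ m ih => rw [pow_succ]; exact mul_mem_cubePoly ih hf

lemma prod_pow_mem_cubePoly {σ : Type*} (s : Finset σ) {f : σ → Finset ι → ℝ}
    (hf : ∀ v, f v ∈ cubePoly ι 1) (m : σ → ℕ) :
    ∏ v ∈ s, f v ^ m v ∈ cubePoly ι (∑ v ∈ s, m v) := by
  classical
  induction s using Finset.induction_on with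
  | empty => simpa using one_mem_cubePoly 0
  | insert v s hv ih =>
    rw [Finset.prod_insert hv, Finset.sum_insert hv]
    exact mul_mem_cubePoly (pow_mem_cubePoly (hf v) _) ih

/-- Polynomials of degree at most `d` pull back to functions of degree at most `d`. -/
lemma eval_mem_cubePoly {σ : Type*} {P : MvPolynomial σ ℝ} {d : ℕ}
    (hP : P.totalDegree ≤ d) {f : σ → Finset ι → ℝ} (hf : ∀ v, f v ∈ cubePoly ι 1) :
    (fun T => eval (fun v => f v T) P) ∈ cubePoly ι d := by
  have h : (fun T => eval (fun v => f v T) P) =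
      ∑ m ∈ P.support, coeff m P • ∏ v ∈ m.support, f v ^ m v := by
    ext T
    simp [eval_eq, Finset.sum_apply, Finset.prod_apply]
  rw [h]
  exact Submodule.sum_mem _ fun m hm => Submodule.smul_mem _ _ <|
    cubePoly_mono ((le_totalDegree hm).trans hP) (prod_pow_mem_cubePoly _ hf _)

variable [Fintype ι]

lemma card_supersets (S : Finset ι) {t : ℕ} (h : S.card ≤ t) :
    ((Finset.powersetCard t Finset.univ).filter fun T => S ⊆ T).card =
      (Fintype.card ι - S.card).choose (t - S.card) := by
  rw [← Finset.card_compl, ← Finset.card_powersetCard]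
  refine Finset.card_bij' (fun T _ => T \ S) (fun T _ => T ∪ S) ?_ ?_ ?_ ?_
  · intro T hT
    simp only [Finset.mem_filter, Finset.mem_powersetCard, Finset.subset_univ, true_and] at hT ⊢
    refine ⟨fun x hx => ?_, ?_⟩
    · simp_all
    · rw [Finset.card_sdiff_of_subset hT.2, hT.1]
  · intro T hT
    simp only [Finset.mem_filter, Finset.mem_powersetCard, Finset.subset_univ, true_and] at hT ⊢
    refine ⟨?_, Finset.subset_union_right⟩
    rw [Finset.card_union_of_disjoint, hT.2]
    · omega
    · exact Finset.subset_compl_iff_disjoint_right.1 hT.1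
  · intro T hT
    simp only [Finset.mem_filter] at hT
    exact Finset.sdiff_union_of_subset hT.2
  · intro T hT
    simp only [Finset.mem_powersetCard] at hT
    exact Finset.union_sdiff_cancel_right (Finset.subset_compl_iff_disjoint_right.1 hT.1)

lemma sum_supersetInd (S : Finset ι) (t : ℕ) :
    ((Fintype.card ι).descFactorial S.card : ℝ) *
        ∑ T ∈ Finset.powersetCard t Finset.univ, supersetInd S T =
      (Fintype.card ι).choose t * t.descFactorial S.card := by
  simp only [supersetInd, Finset.sum_boole]
  rcases lt_or_ge t S.card with h | h
  · rw [Nat.descFactorial_of_lt h, Finset.filter_false_of_mem]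
    · simp
    · intro T hT hST
      have := Finset.card_le_card hST
      rw [(Finset.mem_powersetCard.1 hT).2] at this
      omega
  · rw [card_supersets S h]
    norm_cast
    have := Nat.choose_mul (n := Fintype.card ι) h
    rw [Nat.descFactorial_eq_factorial_mul_choose, Nat.descFactorial_eq_factorial_mul_choose,
      mul_assoc, ← this]
    ring

/-- The average over the layer of weight `t` of a function of degree at most `d` is a
polynomial of degree at most `d` in `t`. -/
lemma exists_layer_average {d : ℕ} {f : Finset ι → ℝ} (hf : f ∈ cubePoly ι d) :
    ∃ p : Polynomial ℝ, p.natDegree ≤ d ∧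
      ∀ t : ℕ, ∑ T ∈ Finset.powersetCard t Finset.univ, f T =
        (Fintype.card ι).choose t * p.eval (t : ℝ) := by
  induction hf using Submodule.span_induction with
  | mem f hf =>
    obtain ⟨S, hS, rfl⟩ := hf
    have h0 : ((Fintype.card ι).descFactorial S.card : ℝ) ≠ 0 := by
      simpa [Nat.descFactorial_eq_zero_iff_lt] using Finset.card_le_univ S
    refine ⟨Polynomial.C ((Fintype.card ι).descFactorial S.card : ℝ)⁻¹ *
      descPochhammer ℝ S.card, ?_, fun t => ?_⟩
    · exact (Polynomial.natDegree_C_mul_le _ _).trans ((descPochhammer_natDegree ℝ _).le.trans hS)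
    · rw [Polynomial.eval_mul, Polynomial.eval_C, descPochhammer_eval_eq_descFactorial]
      have := sum_supersetInd S t
      field_simp
      linarith
  | zero => exact ⟨0, by simp, by simp⟩
  | add f g _ _ hf hg =>
    obtain ⟨p, hp, hpt⟩ := hf
    obtain ⟨q, hq, hqt⟩ := hg
    refine ⟨p + q, Polynomial.natDegree_add_le_of_degree_le hp hq, fun t => ?_⟩
    simp [Finset.sum_add_distrib, hpt, hqt, mul_add]
  | smul a f _ hf =>
    obtain ⟨p, hp, hpt⟩ := hf
    refine ⟨Polynomial.C a * p, (Polynomial.natDegree_C_mul_le _ _).trans hp, fun t => ?_⟩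
    simp only [Pi.smul_apply, smul_eq_mul, ← Finset.mul_sum, hpt, Polynomial.eval_mul,
      Polynomial.eval_C]
    ring

lemma apply_empty_of_layers_vanish {d : ℕ} {f : Finset ι → ℝ} (hf : f ∈ cubePoly ι d)
    {F : Finset ℕ} (hF : d + 1 ≤ F.card) (hFι : ∀ t ∈ F, t ≤ Fintype.card ι)
    (h : ∀ T : Finset ι, T.card ∈ F → f T = 0) : f ∅ = 0 := by
  obtain ⟨p, hp, hpt⟩ := exists_layer_average hf
  have hp0 : p = 0 := by
    apply Polynomial.eq_zero_of_natDegree_lt_card_of_eval_eq_zero' p (F.image (fun t : ℕ => (t : ℝ)))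
    · intro x hx
      obtain ⟨t, ht, rfl⟩ := Finset.mem_image.1 hx
      have h1 := hpt t
      rw [Finset.sum_eq_zero fun T hT => h T (by rwa [(Finset.mem_powersetCard.1 hT).2])] at h1
      have h2 : ((Fintype.card ι).choose t : ℝ) ≠ 0 := by
        exact_mod_cast (Nat.choose_pos (hFι t ht)).ne'
      exact (mul_eq_zero.1 h1.symm).resolve_left h2
    · rw [Finset.card_image_of_injective _ Nat.cast_injective]
      omega
  simpa [hp0] using hpt 0

end Cube

/-- The point obtained from `a` by moving `ε` in direction `c s` for every `s ∈ T`. -/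
def cubePoint {n : ℕ} {ι : Type*} (a : Fin n → ℝ) (ε : ℝ) (c : ι → Fin n) (T : Finset ι) :
    Fin n → ℝ :=
  fun v => a v + ε * ((T.filter fun s => c s = v).card : ℝ)

lemma cubePoint_mem_cubePoly {n : ℕ} {ι : Type*} [DecidableEq ι] [Fintype ι]
    (a : Fin n → ℝ) (ε : ℝ) (c : ι → Fin n) (v : Fin n) :
    (fun T => cubePoint a ε c T v) ∈ cubePoly ι 1 := by
  have h : (fun T => cubePoint a ε c T v) =
      a v • (1 : Finset ι → ℝ) + ε • ∑ s with c s = v, supersetInd {s} := by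
    ext T
    simp only [cubePoint, Pi.add_apply, Pi.smul_apply, Pi.one_apply, smul_eq_mul, mul_one,
      Finset.sum_apply, supersetInd, Finset.singleton_subset_iff, Finset.sum_boole,
      Finset.filter_filter]
    congr 4
    ext s
    simp [and_comm]
  rw [h]
  exact Submodule.add_mem _ (Submodule.smul_mem _ _ (one_mem_cubePoly 1))
    (Submodule.smul_mem _ _ (Submodule.sum_mem _ fun s _ => supersetInd_mem (by simp)))

lemma eval_eq_zero_of_cube_layers {n : ℕ} {ι : Type*} [Fintype ι] [DecidableEq ι]
    (a : Fin n → ℝ) (ε : ℝ) (c : ι → Fin n) {P : MvPolynomial (Fin n) ℝ} {d : ℕ}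
    (hP : P.totalDegree ≤ d) {F : Finset ℕ} (hF : d + 1 ≤ F.card)
    (hFι : ∀ t ∈ F, t ≤ Fintype.card ι)
    (h : ∀ T : Finset ι, T.card ∈ F → eval (cubePoint a ε c T) P = 0) : eval a P = 0 := by
  have := apply_empty_of_layers_vanish
    (eval_mem_cubePoly hP (cubePoint_mem_cubePoly a ε c)) hF hFι h
  simpa [cubePoint] using this

/-! ### Vanishing on many layers on one side -/

lemma card_filter_sigma_fst_le {n : ℕ} (m : Fin n → ℕ) (T : Finset (Σ v, Fin (m v))) (v : Fin n) :
    (T.filter fun s => s.1 = v).card ≤ m v := by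
  have h : T.filter (fun s => s.1 = v) ⊆
      (Finset.univ : Finset (Fin (m v))).map (Function.Embedding.sigmaMk v) := by
    rintro ⟨w, s⟩ hs
    obtain rfl : w = v := (Finset.mem_filter.1 hs).2
    simp
  simpa using Finset.card_le_card h

lemma sum_card_filter_fst {n : ℕ} {m : Fin n → ℕ} (T : Finset (Σ v, Fin (m v))) :
    ∑ v, (T.filter fun s => s.1 = v).card = T.card :=
  (Finset.card_eq_sum_card_fiberwise (f := Sigma.fst) (t := Finset.univ) (by simp)).symm

section Grid

variable {n : ℕ} {k : Fin n → ℕ}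

lemma wt_le_Ntot {x : Fin n → ℕ} (hx : x ∈ gridSet n k) : wt x ≤ Ntot n k :=
  Finset.sum_le_sum fun i _ => Nat.le_sub_one_of_lt (hx i)

lemma eval_eq_zero_of_layers_above {d : ℕ} {P : MvPolynomial (Fin n) ℝ}
    (hP : P.totalDegree ≤ d) {F : Finset ℕ} (hF : d + 1 ≤ F.card)
    {b : Fin n → ℕ} (hb : b ∈ gridSet n k) (hFb : ∀ t ∈ F, wt b ≤ t ∧ t ≤ Ntot n k)
    (h : ∀ x ∈ gridSet n k, wt x ∈ F → eval (toR x) P = 0) : eval (toR b) P = 0 := by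
  have hcard : wt b + ∑ v, (k v - 1 - b v) = Ntot n k := by
    unfold wt Ntot
    rw [← Finset.sum_add_distrib]
    exact Finset.sum_congr rfl fun v _ => by have := hb v; omega
  refine eval_eq_zero_of_cube_layers (ι := Σ v, Fin (k v - 1 - b v)) (toR b) 1 Sigma.fst hP
    (F := F.image fun t => t - wt b) ?_ ?_ ?_
  · rwa [Finset.card_image_of_injOn]
    intro s hs t ht hst
    have := hFb s hs
    have := hFb t ht
    simp only at hst
    omega
  · intro t ht
    obtain ⟨s, hs, rfl⟩ := Finset.mem_image.1 ht
    have := hFb s hs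
    simp only [Fintype.card_sigma, Fintype.card_fin]
    omega
  · intro T hT
    obtain ⟨s, hs, hsT⟩ := Finset.mem_image.1 hT
    have := hFb s hs
    have hx : cubePoint (toR b) 1 Sigma.fst T =
        toR fun v => b v + (T.filter fun s => s.1 = v).card := by
      ext v
      simp [cubePoint, toR]
    rw [hx]
    apply h
    · intro v
      have := card_filter_sigma_fst_le _ T v
      have := hb v
      dsimp only
      omega
    · have : wt (fun v => b v + (T.filter fun s => s.1 = v).card) = wt b + T.card := by
        unfold wt
        rw [Finset.sum_add_distrib, sum_card_filter_fst]
      rw [this, ← hsT]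
      convert hs using 1
      omega

lemma eval_eq_zero_of_layers_below {d : ℕ} {P : MvPolynomial (Fin n) ℝ}
    (hP : P.totalDegree ≤ d) {F : Finset ℕ} (hF : d + 1 ≤ F.card)
    {b : Fin n → ℕ} (hb : b ∈ gridSet n k) (hFb : ∀ t ∈ F, t ≤ wt b)
    (h : ∀ x ∈ gridSet n k, wt x ∈ F → eval (toR x) P = 0) : eval (toR b) P = 0 := by
  refine eval_eq_zero_of_cube_layers (ι := Σ v, Fin (b v)) (toR b) (-1) Sigma.fst hP
    (F := F.image fun t => wt b - t) ?_ ?_ ?_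
  · rwa [Finset.card_image_of_injOn]
    intro s hs t ht hst
    have := hFb s hs
    have := hFb t ht
    simp only at hst
    omega
  · intro t ht
    obtain ⟨s, hs, rfl⟩ := Finset.mem_image.1 ht
    simp [wt]
  · intro T hT
    obtain ⟨s, hs, hsT⟩ := Finset.mem_image.1 hT
    have := hFb s hs
    have hle := card_filter_sigma_fst_le _ T
    have hx : cubePoint (toR b) (-1) Sigma.fst T =
        toR fun v => b v - (T.filter fun s => s.1 = v).card := by
      ext v
      simp [cubePoint, toR, Nat.cast_sub (hle v), sub_eq_add_neg]
    rw [hx]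
    apply h
    · intro v
      have := hb v
      dsimp only
      omega
    · have : wt (fun v => b v - (T.filter fun s => s.1 = v).card) + T.card = wt b := by
        unfold wt
        rw [← sum_card_filter_fst T, ← Finset.sum_add_distrib]
        exact Finset.sum_congr rfl fun v _ => Nat.sub_add_cancel (hle v)
      convert hs using 1
      omega

/-! ### A polynomial vanishing on the extreme layers -/

lemma gridSet_finite : (gridSet n k).Finite :=
  (Set.Finite.pi' fun i => Set.finite_Iio (k i)).subset fun _ hx => hx

lemma layer_finite (j : ℕ) : (layer n k j).Finite :=
  gridSet_finite.subset fun _ hx => hx.1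

lemma ncard_layer_reflect {j : ℕ} (hj : j ≤ Ntot n k) :
    (layer n k (Ntot n k - j)).ncard = (layer n k j).ncard := by
  have hadd : ∀ x ∈ gridSet n k, wt (fun v => k v - 1 - x v) + wt x = Ntot n k := by
    intro x hx
    unfold wt Ntot
    rw [← Finset.sum_add_distrib]
    exact Finset.sum_congr rfl fun v _ => by have := hx v; omega
  have hmem : ∀ x ∈ gridSet n k, (fun v => k v - 1 - x v) ∈ gridSet n k := by
    intro x hx v
    have := hx v
    dsimp only
    omega
  refine Set.ncard_congr (fun x _ v => k v - 1 - x v) ?_ ?_ ?_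
  · rintro x ⟨hx, hw⟩
    have := hadd x hx
    exact ⟨hmem x hx, by omega⟩
  · rintro x y ⟨hx, -⟩ ⟨hy, -⟩ hxy
    ext v
    have := congrFun hxy v
    have := hx v
    have := hy v
    omega
  · rintro y ⟨hy, hw⟩
    refine ⟨fun v => k v - 1 - y v, ⟨hmem y hy, ?_⟩, ?_⟩
    · have := hadd y hy
      omega
    · ext v
      have := hy v
      dsimp only
      omega

/-- The falling factorial monomial `∏ᵥ Xᵥ (Xᵥ - 1) ⋯ (Xᵥ - aᵥ + 1)`. -/
def fallingMonomial (a : Fin n → ℕ) : MvPolynomial (Fin n) ℝ :=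
  ∏ v, ∏ l ∈ Finset.range (a v), (X v - C (l : ℝ))

lemma totalDegree_fallingMonomial_le (a : Fin n → ℕ) : (fallingMonomial a).totalDegree ≤ wt a := by
  refine (totalDegree_finsetProd _ _).trans (Finset.sum_le_sum fun v _ => ?_)
  refine (totalDegree_finsetProd _ _).trans ((Finset.sum_le_sum (g := fun _ => 1) fun l _ => ?_).trans
    (by simp))
  exact (totalDegree_sub_C_le _ _).trans (totalDegree_X v).le

lemma eval_fallingMonomial (a x : Fin n → ℕ) :
    eval (toR x) (fallingMonomial a) = ∏ v, ((x v).descFactorial (a v) : ℝ) := by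
  simp only [fallingMonomial, map_prod, map_sub, eval_X, eval_C, toR]
  refine Finset.prod_congr rfl fun v _ => ?_
  rw [← descPochhammer_eval_eq_descFactorial, descPochhammer_eval_eq_prod_range]

lemma eval_fallingMonomial_eq_zero {a x : Fin n → ℕ} (h : wt x ≤ wt a) (hne : x ≠ a) :
    eval (toR x) (fallingMonomial a) = 0 := by
  have : ∃ v, x v < a v := by
    by_contra! hle
    refine hne (funext fun v => le_antisymm ?_ (hle v))
    exact ((Finset.sum_eq_sum_iff_of_le fun v _ => hle v).1
      (le_antisymm (Finset.sum_le_sum fun v _ => hle v) h) v (Finset.mem_univ v)).ge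
  obtain ⟨v, hv⟩ := this
  rw [eval_fallingMonomial]
  exact Finset.prod_eq_zero (Finset.mem_univ v) (by simp [Nat.descFactorial_of_lt hv])

lemma eval_fallingMonomial_self_ne_zero (a : Fin n → ℕ) :
    eval (toR a) (fallingMonomial a) ≠ 0 := by
  rw [eval_fallingMonomial]
  exact Finset.prod_ne_zero_iff.2 fun v _ => by
    simp [Nat.descFactorial_self, Nat.factorial_ne_zero]

lemma exists_poly_vanishing_on_layer {i j : ℕ}
    (hij : (layer n k j).ncard < (layer n k i).ncard) :
    ∃ P : MvPolynomial (Fin n) ℝ, P.totalDegree ≤ i ∧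
      (∀ x, wt x < i → eval (toR x) P = 0) ∧
      (∀ x ∈ layer n k j, eval (toR x) P = 0) ∧
      ∃ x ∈ layer n k i, eval (toR x) P ≠ 0 := by
  classical
  have := (layer_finite (n := n) (k := k) i).fintype
  have := (layer_finite (n := n) (k := k) j).fintype
  let M : Matrix (layer n k j) (layer n k i) ℝ :=
    Matrix.of fun x a => eval (toR x.1) (fallingMonomial a.1)
  have hker : M.mulVecLin.ker ≠ ⊥ := by
    apply LinearMap.ker_ne_bot_of_finrank_lt
    simpa [← Nat.card_eq_fintype_card, Nat.card_coe_set_eq] using hij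
  obtain ⟨c, hc, hc0⟩ := Submodule.exists_mem_ne_zero_of_ne_bot hker
  obtain ⟨b, hb⟩ := Function.ne_iff.1 hc0
  have heval : ∀ x, eval (toR x) (∑ a, C (c a) * fallingMonomial a.1) =
      ∑ a, c a * eval (toR x) (fallingMonomial a.1) := by simp
  refine ⟨∑ a, C (c a) * fallingMonomial a.1, ?_, ?_, ?_, b, b.2, ?_⟩
  · refine totalDegree_finsetSum_le fun a _ => (totalDegree_mul _ _).trans ?_
    simpa [a.2.2] using totalDegree_fallingMonomial_le a.1
  · intro x hx
    rw [heval]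
    refine Finset.sum_eq_zero fun a _ => ?_
    have ha := a.2.2
    rw [eval_fallingMonomial_eq_zero (by omega) (by rintro rfl; omega), mul_zero]
  · intro x hx
    rw [heval]
    have := congrFun (LinearMap.mem_ker.1 hc) ⟨x, hx⟩
    simpa [M, Matrix.mulVec, dotProduct, mul_comm] using this
  · rw [heval, Finset.sum_eq_single b]
    · exact mul_ne_zero hb (eval_fallingMonomial_self_ne_zero _)
    · intro a _ hab
      rw [eval_fallingMonomial_eq_zero (by rw [a.2.2, b.2.2]) (fun h => hab (Subtype.ext h.symm)),
        mul_zero]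
    · simp

/-- In a strictly unimodal grid, some polynomial of degree at most `i` vanishes on the `i` lowest
and the `i` highest layers, but on no layer in between. -/
lemma exists_poly_vanishing_on_extreme_layers (hSU : SU2 n k) {i : ℕ} (hi : 1 ≤ i)
    (hiN : 2 * i ≤ Ntot n k) :
    ∃ P : MvPolynomial (Fin n) ℝ, P.totalDegree ≤ i ∧
      (∀ x ∈ gridSet n k, wt x < i ∨ Ntot n k - i < wt x → eval (toR x) P = 0) ∧
      ∀ j, i ≤ j → j ≤ Ntot n k - i → ∃ x ∈ layer n k j, eval (toR x) P ≠ 0 := by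
  have hlt : (layer n k (Ntot n k - (i - 1))).ncard < (layer n k i).ncard := by
    rw [ncard_layer_reflect (by omega)]
    have := hSU.1 (i - 1) (by omega)
    rwa [Nat.sub_add_cancel hi] at this
  obtain ⟨P, hP, hlow, hmid, b, hb, hb0⟩ := exists_poly_vanishing_on_layer hlt
  have hhigh : ∀ x ∈ gridSet n k, Ntot n k - i < wt x → eval (toR x) P = 0 := by
    intro x hx hw
    refine eval_eq_zero_of_layers_below hP (F := insert (Ntot n k - (i - 1)) (Finset.range i))
      ?_ hx ?_ ?_
    · rw [Finset.card_insert_of_notMem (by simp; omega), Finset.card_range]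
    · intro t ht
      rw [Finset.mem_insert, Finset.mem_range] at ht
      omega
    · intro y hy hyF
      rw [Finset.mem_insert, Finset.mem_range] at hyF
      rcases hyF with h | h
      · exact hmid y ⟨hy, h⟩
      · exact hlow y h
  refine ⟨P, hP, fun x hx => Or.rec (hlow x) (hhigh x hx), fun j hij hj => ?_⟩
  by_contra! hjz
  apply hb0
  rcases le_total j i with h | h
  · obtain rfl : i = j := le_antisymm hij h
    exact hjz b hb
  · refine eval_eq_zero_of_layers_above hP (F := insert j (Finset.Ioc (Ntot n k - i) (Ntot n k)))
      ?_ hb.1 ?_ ?_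
    · rw [Finset.card_insert_of_notMem (by simp; omega), Nat.card_Ioc]
      omega
    · intro t ht
      rw [Finset.mem_insert, Finset.mem_Ioc] at ht
      have := hb.2
      omega
    · intro y hy hyF
      rw [Finset.mem_insert, Finset.mem_Ioc] at hyF
      rcases hyF with h | h
      · exact hjz y ⟨hy, h⟩
      · exact hhigh y hy h.1

/-! ### Closed sets of weights -/

/-- The product of the linear polynomials `wt - t` over `t ∈ F`. -/
def weightProd (n : ℕ) (F : Finset ℕ) : MvPolynomial (Fin n) ℝ :=
  ∏ t ∈ F, (∑ v, X v - C (t : ℝ))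

lemma totalDegree_weightProd_le (F : Finset ℕ) : (weightProd n F).totalDegree ≤ F.card := by
  refine (totalDegree_finsetProd _ _).trans ((Finset.sum_le_sum (g := fun _ => 1) fun l _ => ?_).trans
    (by simp))
  exact (totalDegree_sub_C_le _ _).trans
    (totalDegree_finsetSum_le fun v _ => (totalDegree_X v).le)

lemma eval_weightProd_eq_zero_iff (F : Finset ℕ) (x : Fin n → ℕ) :
    eval (toR x) (weightProd n F) = 0 ↔ wt x ∈ F := by
  have h : ∀ t : ℕ, ∑ v, (x v : ℝ) - t = 0 ↔ wt x = t := by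
    intro t
    rw [sub_eq_zero, wt]
    exact_mod_cast Iff.rfl
  simp [weightProd, toR, Finset.prod_eq_zero_iff, h]

lemma exists_mem_layer {j : ℕ} (hj : j ≤ Ntot n k) (hk : ∀ i, 2 ≤ k i) :
    (layer n k j).Nonempty := by
  induction j with
  | zero => exact ⟨0, fun i => by have := hk i; simp; omega, by simp [wt]⟩
  | succ j ih =>
    obtain ⟨x, hx, hw⟩ := ih (by omega)
    have : ∃ v, x v < k v - 1 := by
      by_contra! h
      have : Ntot n k ≤ wt x := Finset.sum_le_sum fun v _ => h v
      omega
    obtain ⟨v, hv⟩ := this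
    refine ⟨x + Pi.single v 1, fun w => ?_, ?_⟩
    · by_cases h : w = v
      · subst h
        simp
        omega
      · simpa [h] using hx w
    · rw [← hw]
      simp [wt, Finset.sum_add_distrib]

/-- If `F` is closed under `Lop` and misses `j`, then the weights in `F` are separated from `j`
by a polynomial of degree at most `d`. -/
lemma exists_separating_poly (hk : ∀ i, 2 ≤ k i) (hSU : SU2 n k) {d j : ℕ} {F : Finset ℕ}
    (hF : F ⊆ Finset.range (Ntot n k + 1)) (hFL : Lop (Ntot n k) d F ⊆ F)
    (hj : j ≤ Ntot n k) (hjF : j ∉ F) :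
    ∃ P : MvPolynomial (Fin n) ℝ, P.totalDegree ≤ d ∧
      (∀ x ∈ wdSet n k F, eval (toR x) P = 0) ∧ ∃ x ∈ layer n k j, eval (toR x) P ≠ 0 := by
  rcases le_or_gt F.card d with hd | hd
  · obtain ⟨x, hx⟩ := exists_mem_layer hj hk
    refine ⟨weightProd n F, (totalDegree_weightProd_le F).trans hd,
      fun x hx => (eval_weightProd_eq_zero_iff F x).2 hx.2, x, hx, ?_⟩
    rw [Ne, eval_weightProd_eq_zero_iff, hx.2]
    exact hjF
  obtain ⟨i, hi⟩ := Nat.exists_eq_add_of_lt hd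
  have hout : ∀ x ≤ Ntot n k, x ∉ F → i + 1 ≤ x ∧ x + (i + 1) ≤ Ntot n k := by
    intro x hx hxF
    have hL : ¬ (d + 1 ≤ (F.filter fun t => x ≤ t).card ∨
        d + 1 ≤ (F.filter fun t => t ≤ x).card) := by
      intro h
      exact hxF (hFL (Finset.mem_union_right _
        (Finset.mem_filter.2 ⟨Finset.mem_range.2 (by omega), h⟩)))
    push Not at hL
    have h1 := Finset.card_filter_add_card_filter_not (s := F) fun t => x ≤ t
    have h2 := Finset.card_filter_add_card_filter_not (s := F) fun t => t ≤ x
    have h3 : (F.filter fun t => ¬ x ≤ t).card ≤ x := by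
      have : F.filter (fun t => ¬ x ≤ t) ⊆ Finset.range x := by
        intro t ht
        simp_all
      simpa using Finset.card_le_card this
    have h4 : (F.filter fun t => ¬ t ≤ x).card ≤ Ntot n k - x := by
      have : F.filter (fun t => ¬ t ≤ x) ⊆ Finset.Ioc x (Ntot n k) := by
        intro t ht
        have := Finset.mem_filter.1 ht
        have := Finset.mem_range.1 (hF this.1)
        rw [Finset.mem_Ioc]
        omega
      simpa using Finset.card_le_card this
    omega
  have hjout := hout j hj hjF
  obtain ⟨Q, hQ, hQ0, hQj⟩ :=
    exists_poly_vanishing_on_extreme_layers hSU (i := i + 1) (by omega) (by omega)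
  set F' := F.filter fun t => i + 1 ≤ t ∧ t ≤ Ntot n k - (i + 1) with hF'
  have hcard : F'.card + (i + 1) ≤ d := by
    have hsub : F' ∪ (Finset.range (i + 1) ∪ Finset.Ioc (Ntot n k - (i + 1)) (Ntot n k)) ⊆ F := by
      intro t ht
      by_contra htF
      have htN : t ≤ Ntot n k := by
        simp only [Finset.mem_union, Finset.mem_range, Finset.mem_Ioc, hF', Finset.mem_filter] at ht
        rcases ht with h | h | h
        · exact absurd h.1 htF
        · omega
        · omega
      have := hout t htN htF
      simp only [Finset.mem_union, Finset.mem_range, Finset.mem_Ioc, hF', Finset.mem_filter, htF,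
        false_and, false_or] at ht
      omega
    have := Finset.card_le_card hsub
    rw [Finset.card_union_of_disjoint, Finset.card_union_of_disjoint, Finset.card_range,
      Nat.card_Ioc] at this
    · omega
    · rw [Finset.disjoint_left]
      intro t ht
      simp only [Finset.mem_range, Finset.mem_Ioc] at *
      omega
    · rw [Finset.disjoint_left]
      intro t ht
      simp only [Finset.mem_union, Finset.mem_range, Finset.mem_Ioc, hF', Finset.mem_filter] at *
      omega
  obtain ⟨x, hx, hxQ⟩ := hQj j (by omega) (by omega)
  refine ⟨weightProd n F' * Q, (totalDegree_mul _ _).trans ?_, fun y hy => ?_, x, hx, ?_⟩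
  · have := totalDegree_weightProd_le (n := n) F'
    omega
  · rw [map_mul, mul_eq_zero]
    by_cases h : i + 1 ≤ wt y ∧ wt y ≤ Ntot n k - (i + 1)
    · exact Or.inl ((eval_weightProd_eq_zero_iff F' y).2 (Finset.mem_filter.2 ⟨hy.2, h⟩))
    · exact Or.inr (hQ0 y hy.1 (by omega))
  · rw [map_mul]
    refine mul_ne_zero ?_ hxQ
    rw [Ne, eval_weightProd_eq_zero_iff, hx.2]
    exact fun h => hjF (Finset.mem_filter.1 h).1

end Grid

lemma subset_Lop (N d : ℕ) (E : Finset ℕ) : E ⊆ Lop N d E := Finset.subset_union_left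

lemma Lop_subset_range {N d : ℕ} {E : Finset ℕ} (hE : E ⊆ Finset.range (N + 1)) :
    Lop N d E ⊆ Finset.range (N + 1) :=
  Finset.union_subset hE (Finset.filter_subset _ _)

lemma iterate_Lop_subset_range {N : ℕ} (d : ℕ) {E : Finset ℕ} (hE : E ⊆ Finset.range (N + 1))
    (m : ℕ) : (Lop N d)^[m] E ⊆ Finset.range (N + 1) := by
  induction m with
  | zero => exact hE
  | succ m ih => rw [Function.iterate_succ_apply']; exact Lop_subset_range ih

lemma subset_iterate_Lop (N d : ℕ) (E : Finset ℕ) (m : ℕ) : E ⊆ (Lop N d)^[m] E := by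
  induction m with
  | zero => exact subset_rfl
  | succ m ih => rw [Function.iterate_succ_apply']; exact ih.trans (subset_Lop _ _ _)

/-- The iterates of `Lop` reach a closed set. -/
lemma exists_iterate_Lop_closed {N : ℕ} (d : ℕ) {E : Finset ℕ} (hE : E ⊆ Finset.range (N + 1)) :
    ∃ m, Lop N d ((Lop N d)^[m] E) ⊆ (Lop N d)^[m] E := by
  by_contra! h
  have hcard : ∀ m, m ≤ ((Lop N d)^[m] E).card := by
    intro m
    induction m with
    | zero => exact Nat.zero_le _
    | succ m ih =>
      rw [Function.iterate_succ_apply']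
      exact ih.trans_lt (Finset.card_lt_card ⟨subset_Lop _ _ _, h m⟩)
  have h1 := hcard (N + 2)
  have h2 := Finset.card_le_card (iterate_Lop_subset_range d hE (N + 2))
  rw [Finset.card_range] at h2
  omega

/-- A polynomial of degree at most `d` that vanishes on the layers in `E` vanishes on the layers
in `Lop N d E`. -/
lemma eval_eq_zero_of_mem_Lop {n : ℕ} {k : Fin n → ℕ} {d : ℕ} {E : Finset ℕ}
    (hE : E ⊆ Finset.range (Ntot n k + 1)) {P : MvPolynomial (Fin n) ℝ} (hP : P.totalDegree ≤ d)
    (h : ∀ x ∈ wdSet n k E, eval (toR x) P = 0) :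
    ∀ x ∈ wdSet n k (Lop (Ntot n k) d E), eval (toR x) P = 0 := by
  rintro x ⟨hx, hw⟩
  rcases Finset.mem_union.1 hw with hw | hw
  · exact h x ⟨hx, hw⟩
  rcases (Finset.mem_filter.1 hw).2 with hw | hw
  · refine eval_eq_zero_of_layers_above hP hw hx (fun t ht => ?_) fun y hy hyF =>
      h y ⟨hy, (Finset.mem_filter.1 hyF).1⟩
    rw [Finset.mem_filter] at ht
    exact ⟨ht.2, Nat.lt_succ_iff.1 (Finset.mem_range.1 (hE ht.1))⟩
  · exact eval_eq_zero_of_layers_below hP hw hx (fun t ht => (Finset.mem_filter.1 ht).2)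
      fun y hy hyF => h y ⟨hy, (Finset.mem_filter.1 hyF).1⟩

/-- for an SU² grid, `Z*-cl_{G,d}(E) = L̄_{N,d}(E)`. -/
theorem stmt5 (n : ℕ) (hn : 1 ≤ n) (k : Fin n → ℕ) (hk : ∀ i, 2 ≤ k i) (hSU : SU2 n k)
    (d : ℕ) (hd : d ≤ Ntot n k) (E : Finset ℕ) (hE : E ⊆ Finset.range (Ntot n k + 1)) :
    Zstar n k d E = Lbar (Ntot n k) d E := by
  apply Set.Subset.antisymm
  · rintro j ⟨hj, hjcl⟩
    by_contra hjL
    obtain ⟨m, hm⟩ := exists_iterate_Lop_closed d hE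
    obtain ⟨P, hP, hP0, x, hx, hxP⟩ := exists_separating_poly hk hSU
      (iterate_Lop_subset_range d hE m) hm hj fun h => hjL (Set.mem_iUnion.2 ⟨m, h⟩)
    exact hxP ((hjcl hx).2 P hP fun y hy => hP0 y ⟨hy.1, subset_iterate_Lop _ _ _ _ hy.2⟩)
  · intro j hj
    obtain ⟨m, hm⟩ := Set.mem_iUnion.1 hj
    rw [Finset.mem_coe] at hm
    refine ⟨Nat.lt_succ_iff.1 (Finset.mem_range.1 (iterate_Lop_subset_range d hE m hm)),
      fun x hx => ⟨hx.1, fun P hP h => ?_⟩⟩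
    have hall : ∀ m, ∀ y ∈ wdSet n k ((Lop (Ntot n k) d)^[m] E), eval (toR y) P = 0 := by
      intro m
      induction m with
      | zero => exact h
      | succ m ih =>
        rw [Function.iterate_succ_apply']
        exact eval_eq_zero_of_mem_Lop (iterate_Lop_subset_range d hE m) hP ih
    exact hall m x ⟨hx.1, by rwa [hx.2]⟩

end CoveringSymmetric
end
end

section
/- Let G be a uniform grid, d ∈ {0,…,N}, and E ⊆ {0,…,N} with |E| ≤ d. Then Z*-cl_{G,d}(E) = E. -/
open MvPolynomial

noncomputable section

namespace CoveringSymmetric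

theorem layer_nonempty {n : ℕ} {k : Fin n → ℕ} (hk : ∀ i, 0 < k i) {j : ℕ}
    (hj : j ≤ Ntot n k) : (layer n k j).Nonempty := by
  induction j with
  | zero => exact ⟨0, hk, by simp [wt]⟩
  | succ j ih =>
    obtain ⟨x, hx, hwt⟩ := ih (by omega)
    obtain ⟨i, -, hi⟩ : ∃ i ∈ Finset.univ, x i < k i - 1 :=
      Finset.exists_lt_of_sum_lt (by change wt x < Ntot n k; omega)
    refine ⟨x + Pi.single i 1, fun l => ?_, ?_⟩
    · rcases eq_or_ne l i with rfl | hl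
      · simp only [Pi.add_apply, Pi.single_eq_same]
        omega
      · simpa [hl] using hx l
    · rw [← hwt]
      simp [wt, Finset.sum_add_distrib]

/-- The product `∏ (X₁ + ⋯ + Xₙ - e)` over `e ∈ E`, which vanishes on `E̲`. -/
def weightPoly (n : ℕ) (E : Finset ℕ) : MvPolynomial (Fin n) ℝ :=
  ∏ e ∈ E, (∑ i, X i - C (e : ℝ))

theorem totalDegree_weightPoly_le (n : ℕ) (E : Finset ℕ) :
    (weightPoly n E).totalDegree ≤ E.card := by
  refine (totalDegree_finsetProd _ _).trans ?_
  refine (Finset.sum_le_card_nsmul _ _ 1 fun e _ => ?_).trans (by simp)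
  refine (totalDegree_sub_C_le _ _).trans ?_
  exact totalDegree_finsetSum_le fun i _ => (totalDegree_X i).le

theorem eval_weightPoly_eq_zero_iff {n : ℕ} {E : Finset ℕ} {x : Fin n → ℕ} :
    eval (toR x) (weightPoly n E) = 0 ↔ wt x ∈ E := by
  have h (e : ℕ) : eval (toR x) (∑ i, X i - C (e : ℝ)) = (wt x : ℝ) - e := by
    simp [toR, wt]
  simp only [weightPoly, map_prod, Finset.prod_eq_zero_iff, h, sub_eq_zero, Nat.cast_inj,
    exists_eq_right']

/-- if `|E| ≤ d` then `Z*-cl_{G,d}(E) = E`. -/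
theorem stmt12 (n : ℕ) (hn : 1 ≤ n) (k : Fin n → ℕ) (hk : ∀ i, 2 ≤ k i)
    (d : ℕ) (hd : d ≤ Ntot n k) (E : Finset ℕ) (hE : E ⊆ Finset.range (Ntot n k + 1))
    (hcard : E.card ≤ d) :
    Zstar n k d E = ↑E := by
  ext j
  constructor
  · rintro ⟨hj, hsub⟩
    obtain ⟨a, ha⟩ := layer_nonempty (fun i => by have := hk i; omega) hj
    have hzero := (hsub ha).2 (weightPoly n E) ((totalDegree_weightPoly_le n E).trans hcard)
      fun x hx => eval_weightPoly_eq_zero_iff.2 hx.2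
    simpa [ha.2] using eval_weightPoly_eq_zero_iff.1 hzero
  · intro hj
    refine ⟨Nat.lt_succ_iff.1 (Finset.mem_range.1 (hE hj)), fun a ha => ⟨ha.1, fun P _ hP => ?_⟩⟩
    exact hP a ⟨ha.1, by simpa [ha.2] using hj⟩

end CoveringSymmetric
end
end

section
/- (Closure Builder Lemma) Let G be a uniform grid, d ∈ {0,…,N}, and E ⊆ {0,…,N} with |E| ≥ d+1. Then {0,…,min E} ∪ {max E,…,N} ⊆ Z*-cl_{G,d}(E). -/
open MvPolynomial

noncomputable section

namespace CoveringSymmetric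

theorem totalDegree_bind₁_le {σ τ R : Type*} [CommSemiring R] {g : σ → MvPolynomial τ R}
    (hg : ∀ i, (g i).totalDegree ≤ 1) (P : MvPolynomial σ R) :
    (bind₁ g P).totalDegree ≤ P.totalDegree := by
  conv_lhs => rw [P.as_sum, map_sum]
  refine totalDegree_finsetSum_le fun e he => ?_
  rw [bind₁_monomial]
  refine (totalDegree_mul _ _).trans ?_
  rw [totalDegree_C, zero_add]
  refine (totalDegree_finsetProd _ _).trans (le_trans ?_ (le_totalDegree he))
  refine Finset.sum_le_sum fun i _ => (totalDegree_pow _ _).trans ?_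
  simpa using Nat.mul_le_mul_left (e i) (hg i)

theorem eval_bind₁ {σ τ R : Type*} [CommSemiring R] (f : τ → R) (g : σ → MvPolynomial τ R)
    (P : MvPolynomial σ R) : eval f (bind₁ g P) = eval (fun i => eval f (g i)) P := by
  simpa [aeval_eq_eval] using aeval_bind₁ f g P

section BooleanCube

variable {V : Type*} [DecidableEq V]

/-- The `0`-`1` indicator vector of a finite set. -/
def indicatorVec (A : Finset V) : V → ℝ := fun v => if v ∈ A then 1 else 0

theorem eval_indicatorVec (Q : MvPolynomial V ℝ) (A : Finset V) :
    eval (indicatorVec A) Q = ∑ e ∈ Q.support, Q.coeff e * if e.support ⊆ A then 1 else 0 := by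
  rw [eval_eq]
  refine Finset.sum_congr rfl fun e _ => congrArg _ ?_
  split_ifs with h
  · exact Finset.prod_eq_one fun v hv => by simp [indicatorVec, h hv]
  · obtain ⟨v, hv, hvA⟩ := Finset.not_subset.1 h
    refine Finset.prod_eq_zero hv ?_
    simp [indicatorVec, hvA, Finsupp.mem_support_iff.1 hv]

theorem card_filter_subset_mul_descFactorial {A B : Finset V} (hBA : B ⊆ A) (s : ℕ) :
    ((A.powersetCard s).filter (B ⊆ ·)).card * A.card.descFactorial B.card =
      A.card.choose s * s.descFactorial B.card := by
  rcases le_or_gt B.card s with h | h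
  · rw [Finset.card_filter_powersetCard_subset B A s hBA h, Nat.descFactorial_eq_factorial_mul_choose,
      Nat.descFactorial_eq_factorial_mul_choose, mul_left_comm, mul_comm (Nat.choose _ _),
      ← Nat.choose_mul h, mul_left_comm]
  · rw [Nat.descFactorial_eq_zero_iff_lt.2 h, Finset.filter_false_of_mem, Finset.card_empty,
      zero_mul, mul_zero]
    intro U hU hBU
    have := Finset.card_le_card hBU
    rw [(Finset.mem_powersetCard.1 hU).2] at this
    omega

variable [Fintype V]

/-- The polynomial interpolating `s ↦` average of `Q` over the supersets of `A` with
`A.card + s` elements. -/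
def upwardAverage (Q : MvPolynomial V ℝ) (A : Finset V) : Polynomial ℝ :=
  ∑ e ∈ Q.support,
    Polynomial.C (Q.coeff e / (Aᶜ.card.descFactorial (e.support \ A).card : ℝ)) *
      descPochhammer ℝ (e.support \ A).card

theorem natDegree_upwardAverage_le (Q : MvPolynomial V ℝ) (A : Finset V) :
    (upwardAverage Q A).natDegree ≤ Q.totalDegree := by
  refine Polynomial.natDegree_sum_le_of_forall_le _ _ fun e he => ?_
  refine (Polynomial.natDegree_C_mul_le _ _).trans ?_
  rw [descPochhammer_natDegree]
  refine (Finset.card_le_card Finset.sdiff_subset).trans (le_trans ?_ (le_totalDegree he))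
  rw [Finset.card_eq_sum_ones]
  exact Finset.sum_le_sum fun v hv => Nat.one_le_iff_ne_zero.2 (Finsupp.mem_support_iff.1 hv)

theorem choose_mul_eval_upwardAverage (Q : MvPolynomial V ℝ) (A : Finset V) (s : ℕ) :
    (Aᶜ.card.choose s : ℝ) * (upwardAverage Q A).eval (s : ℝ) =
      ∑ U ∈ Aᶜ.powersetCard s, eval (indicatorVec (A ∪ U)) Q := by
  simp_rw [eval_indicatorVec]
  rw [Finset.sum_comm, upwardAverage, Polynomial.eval_finsetSum, Finset.mul_sum]
  refine Finset.sum_congr rfl fun e _ => ?_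
  have hsub : e.support \ A ⊆ Aᶜ := fun v hv => by
    simpa using (Finset.mem_sdiff.1 hv).2
  have hcount := card_filter_subset_mul_descFactorial hsub s
  have hpos : (Aᶜ.card.descFactorial (e.support \ A).card : ℝ) ≠ 0 := by
    rw [Nat.cast_ne_zero, Ne, Nat.descFactorial_eq_zero_iff_lt, not_lt]
    exact Finset.card_le_card hsub
  rw [← Finset.mul_sum, Finset.sum_boole]
  have hiff (U : Finset V) : e.support ⊆ A ∪ U ↔ e.support \ A ⊆ U := sdiff_le_iff.symm
  simp_rw [hiff]
  rw [Polynomial.eval_mul, Polynomial.eval_C, descPochhammer_eval_eq_descFactorial]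
  have hcount' := congrArg (Nat.cast : ℕ → ℝ) hcount
  push_cast at hcount'
  field_simp
  linear_combination -Q.coeff e * hcount'

theorem eval_indicatorVec_eq_zero_of_le {d : ℕ} {Q : MvPolynomial V ℝ} (hQ : Q.totalDegree ≤ d)
    {E : Finset ℕ} (hE : ∀ t ∈ E, t ≤ Fintype.card V) (hcard : d < E.card)
    (hvan : ∀ B : Finset V, B.card ∈ E → eval (indicatorVec B) Q = 0)
    {A : Finset V} (hA : ∀ t ∈ E, A.card ≤ t) : eval (indicatorVec A) Q = 0 := by
  have hinj : Set.InjOn (fun t : ℕ => ((t - A.card : ℕ) : ℝ)) E := fun t ht u hu h => by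
    have := hA t ht
    have := hA u hu
    have : t - A.card = u - A.card := Nat.cast_injective h
    omega
  have hzero : upwardAverage Q A = 0 := by
    refine Polynomial.eq_zero_of_natDegree_lt_card_of_eval_eq_zero' _
      (E.image fun t : ℕ => ((t - A.card : ℕ) : ℝ)) ?_ ?_
    · simp only [Finset.forall_mem_image]
      intro t ht
      have h := choose_mul_eval_upwardAverage Q A (t - A.card)
      rw [Finset.sum_eq_zero] at h
      · refine (mul_eq_zero.1 h).resolve_left ?_
        rw [Nat.cast_eq_zero, Finset.card_compl]
        exact (Nat.choose_pos (Nat.sub_le_sub_right (hE t ht) _)).ne'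
      · intro U hU
        obtain ⟨hUA, hUc⟩ := Finset.mem_powersetCard.1 hU
        apply hvan
        rw [Finset.card_union_of_disjoint, hUc, Nat.add_sub_cancel' (hA t ht)]
        · exact ht
        · exact Finset.disjoint_of_subset_right hUA disjoint_compl_right
    · rw [Finset.card_image_of_injOn hinj]
      exact ((natDegree_upwardAverage_le Q A).trans hQ).trans_lt hcard
  have h := choose_mul_eval_upwardAverage Q A 0
  simpa [hzero] using h.symm

theorem eval_indicatorVec_eq_zero_of_ge {d : ℕ} {Q : MvPolynomial V ℝ} (hQ : Q.totalDegree ≤ d)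
    {E : Finset ℕ} (hE : ∀ t ∈ E, t ≤ Fintype.card V) (hcard : d < E.card)
    (hvan : ∀ B : Finset V, B.card ∈ E → eval (indicatorVec B) Q = 0)
    {A : Finset V} (hA : ∀ t ∈ E, t ≤ A.card) : eval (indicatorVec A) Q = 0 := by
  have hdeg (v : V) : (1 - X v : MvPolynomial V ℝ).totalDegree ≤ 1 :=
    (totalDegree_sub _ _).trans (by simp)
  have hflip (B : Finset V) :
      eval (indicatorVec B) (bind₁ (fun v => 1 - X v) Q) = eval (indicatorVec Bᶜ) Q := by
    rw [eval_bind₁]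
    congr 2
    funext v
    by_cases hv : v ∈ B <;> simp [indicatorVec, hv]
  have hinj : Set.InjOn (fun t => Fintype.card V - t) E := fun t ht u hu h => by
    have := hE t ht
    have := hE u hu
    dsimp only at h
    omega
  rw [← compl_compl A, ← hflip]
  refine eval_indicatorVec_eq_zero_of_le ((totalDegree_bind₁_le hdeg Q).trans hQ)
    (E := E.image fun t => Fintype.card V - t) ?_ ?_ ?_ ?_
  · simp
  · rwa [Finset.card_image_of_injOn hinj]
  · intro B hB
    rw [hflip]
    apply hvan
    obtain ⟨t, ht, hB⟩ := Finset.mem_image.1 hB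
    rw [Finset.card_compl, ← hB, Nat.sub_sub_self (hE t ht)]
    exact ht
  · simp only [Finset.forall_mem_image, Finset.card_compl]
    exact fun t ht => Nat.sub_le_sub_left (hA t ht) _

end BooleanCube

section GridLift

variable {n : ℕ} {k : Fin n → ℕ}

/-- The grid point whose `i`-th coordinate counts the elements of `A` in the `i`-th block. -/
def blockCount (A : Finset (Σ i, Fin (k i - 1))) : Fin n → ℕ :=
  fun i => (Finset.univ.filter fun a : Fin (k i - 1) => (⟨i, a⟩ : Σ i, Fin (k i - 1)) ∈ A).card

theorem wt_blockCount (A : Finset (Σ i, Fin (k i - 1))) : wt (blockCount A) = A.card := by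
  simp only [wt, blockCount]
  rw [← Finset.card_sigma]
  congr 1
  ext
  simp

theorem blockCount_mem_gridSet (hk : ∀ i, 0 < k i) (A : Finset (Σ i, Fin (k i - 1))) :
    blockCount A ∈ gridSet n k := by
  intro i
  have h : blockCount A i ≤ k i - 1 := by
    simpa [blockCount] using Finset.card_le_univ
      (Finset.univ.filter fun a : Fin (k i - 1) => (⟨i, a⟩ : Σ i, Fin (k i - 1)) ∈ A)
  have := hk i
  omega

theorem exists_blockCount_eq {x : Fin n → ℕ} (hx : x ∈ gridSet n k) :
    ∃ A : Finset (Σ i, Fin (k i - 1)), blockCount A = x := by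
  refine ⟨Finset.univ.filter fun v => v.2.val < x v.1, funext fun i => ?_⟩
  have h : x i ≤ k i - 1 := Nat.le_sub_one_of_lt (hx i)
  simp [blockCount, Fin.card_filter_val_lt, h]

/-- The pullback of `P` along the map sending a point of the Boolean cube to its block sums. -/
def blockPullback (P : MvPolynomial (Fin n) ℝ) : MvPolynomial (Σ i, Fin (k i - 1)) ℝ :=
  bind₁ (fun i => ∑ a, X ⟨i, a⟩) P

theorem totalDegree_blockPullback_le (P : MvPolynomial (Fin n) ℝ) :
    (blockPullback (k := k) P).totalDegree ≤ P.totalDegree :=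
  totalDegree_bind₁_le (fun _ => totalDegree_finsetSum_le fun _ _ => (totalDegree_X _).le) P

theorem eval_indicatorVec_blockPullback (P : MvPolynomial (Fin n) ℝ)
    (A : Finset (Σ i, Fin (k i - 1))) :
    eval (indicatorVec A) (blockPullback P) = eval (toR (blockCount A)) P := by
  rw [blockPullback, eval_bind₁]
  congr 2
  funext i
  simp [indicatorVec, toR, blockCount]

end GridLift

/-- Closure Builder Lemma: if `|E| ≥ d+1` then
`[0, min E] ∪ [max E, N] ⊆ Z*-cl_{G,d}(E)`. -/
theorem stmt13 (n : ℕ) (hn : 1 ≤ n) (k : Fin n → ℕ) (hk : ∀ i, 2 ≤ k i)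
    (d : ℕ) (hd : d ≤ Ntot n k) (E : Finset ℕ) (hE : E ⊆ Finset.range (Ntot n k + 1))
    (hne : E.Nonempty) (hcard : d + 1 ≤ E.card) :
    ∀ j ≤ Ntot n k, (j ≤ E.min' hne ∨ E.max' hne ≤ j) → j ∈ Zstar n k d E := by
  intro j hj hjE
  refine ⟨hj, fun x ⟨hx, hxj⟩ => ⟨hx, fun P hP hvan => ?_⟩⟩
  obtain ⟨A, rfl⟩ := exists_blockCount_eq hx
  rw [wt_blockCount] at hxj
  have hQ := (totalDegree_blockPullback_le (k := k) P).trans hP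
  have hEN : ∀ t ∈ E, t ≤ Fintype.card (Σ i, Fin (k i - 1)) := fun t ht => by
    simpa [Ntot, Nat.lt_succ_iff] using hE ht
  have hQvan : ∀ B : Finset (Σ i, Fin (k i - 1)), B.card ∈ E →
      eval (indicatorVec B) (blockPullback P) = 0 := fun B hB => by
    rw [eval_indicatorVec_blockPullback]
    refine hvan _ ⟨blockCount_mem_gridSet (fun i => two_pos.trans_le (hk i)) B, ?_⟩
    rwa [wt_blockCount]
  rw [← eval_indicatorVec_blockPullback]
  rcases hjE with h | h
  · refine eval_indicatorVec_eq_zero_of_le hQ hEN hcard hQvan fun t ht => ?_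
    rw [hxj]
    exact h.trans (E.min'_le t ht)
  · refine eval_indicatorVec_eq_zero_of_ge hQ hEN hcard hQvan fun t ht => ?_
    rw [hxj]
    exact (E.le_max' t ht).trans h

end CoveringSymmetric
end
end
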